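/- arXiv:2503.03025 — 3 statements merged into one kernel-verified Lean document; each statement's English description precedes it below -/
import Mathlib

section
/- Let n and r be positive integers with r dividing n, and let C ∈ ℝ^{n×n} be strictly r-Monge separable with respect to a permutation σ† of [n] minimizing σ ↦ Σ_i C_{i,σ(i)} over all permutations of [n]. Suppose (Q*, R*) minimizes (Q,R) ↦ ⟨C, Q Rᵀ⟩_F over Π_•(u_n,u_r) × Π_•(u_n,u_r), with associated clustering functions q*, r* : [n] → [r]. Then q*(i) = r*(σ†(i)) for every i ∈ [n]; that is, the optimal hard low-rank factors assign each index i and its image σ†(i) under the optimal assignment to the same cluster. -/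
open Matrix Finset

noncomputable section

/-- The uniform probability vector `u_k = (1/k, …, 1/k)`. -/
def unif (k : ℕ) : Fin k → ℝ := fun _ => 1 / k

/-- Membership in the transport polytope `Π(a, b)`. -/
def InPolytope {n m : ℕ} (a : Fin n → ℝ) (b : Fin m → ℝ)
    (P : Matrix (Fin n) (Fin m) ℝ) : Prop :=
  (∀ i j, 0 ≤ P i j) ∧ (∀ i, ∑ j, P i j = a i) ∧ (∀ j, ∑ i, P i j = b j)

/-- Membership in `Π_•(u_n, u_r)`: a coupling with uniform marginals all of whose
rows have exactly one nonzero entry. -/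
def IsHard {n r : ℕ} (Q : Matrix (Fin n) (Fin r) ℝ) : Prop :=
  InPolytope (unif n) (unif r) Q ∧ ∀ i, ∃! z, Q i z ≠ 0

/-- Frobenius inner product `⟨A, B⟩_F`. -/
def frob {n m : ℕ} (A B : Matrix (Fin n) (Fin m) ℝ) : ℝ :=
  ∑ i, ∑ j, A i j * B i j

/-- The block cost `C_{I,J} = ∑_{i ∈ I} ∑_{j ∈ J} C_{i, σ†(j)}`. -/
def blockCost {n : ℕ} (C : Matrix (Fin n) (Fin n) ℝ) (σ : Equiv.Perm (Fin n))
    (I J : Finset (Fin n)) : ℝ :=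
  ∑ i ∈ I, ∑ j ∈ J, C i (σ j)

/-- A balanced partition of `[n]` into `r` blocks of size `n / r`. -/
def IsBalancedPartition {n r : ℕ} (I : Fin r → Finset (Fin n)) : Prop :=
  (∀ k, (I k).card = n / r) ∧ (∀ k l, k ≠ l → Disjoint (I k) (I l)) ∧
    (∀ i, ∃ k, i ∈ I k)

/-- `C` is strictly `r`-Monge separable with respect to the optimal assignment `σ`,
with distinguished balanced partition `I`. -/
def IsStrictlyMongeSeparableWith {n r : ℕ} (C : Matrix (Fin n) (Fin n) ℝ)
    (σ : Equiv.Perm (Fin n)) (I : Fin r → Finset (Fin n)) : Prop :=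
  IsBalancedPartition I ∧
    ∀ π₁ π₂ : Equiv.Perm (Fin n),
      (∑ k, blockCost C σ (I k) (I k) ≤
        ∑ k, blockCost C σ ((I k).image π₁) ((I k).image π₂)) ∧
      ((∃ k, (I k).image π₁ ≠ (I k).image π₂) →
        ∑ k, blockCost C σ (I k) (I k) <
          ∑ k, blockCost C σ ((I k).image π₁) ((I k).image π₂))

/-- The hard factor with uniform row marginal associated with a clustering function. -/
def hardMatrix {n r : ℕ} (f : Fin n → Fin r) : Matrix (Fin n) (Fin r) ℝ :=
  fun i z => if z = f i then 1 / n else 0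

/-- The cluster with label `k` of a clustering function. -/
def cluster {n r : ℕ} (f : Fin n → Fin r) (k : Fin r) : Finset (Fin n) :=
  univ.filter fun i => f i = k

lemma mem_cluster {n r : ℕ} {f : Fin n → Fin r} {k : Fin r} {i : Fin n} :
    i ∈ cluster f k ↔ f i = k := by
  simp [cluster]

lemma IsHard.eq_hardMatrix {n r : ℕ} {Q : Matrix (Fin n) (Fin r) ℝ} (hQ : IsHard Q)
    {q : Fin n → Fin r} (hq : ∀ i z, Q i z ≠ 0 ↔ z = q i) : Q = hardMatrix q := by
  have hzero : ∀ i z, z ≠ q i → Q i z = 0 := fun i z hz => by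
    by_contra h
    exact hz ((hq i z).1 h)
  ext i z
  unfold hardMatrix
  split_ifs with h
  · have hrow := hQ.1.2.1 i
    rw [Finset.sum_eq_single (q i) (fun z _ hz => hzero i z hz) (by simp)] at hrow
    rw [h, hrow, unif]
  · exact hzero i z h

lemma sum_hardMatrix_col {n r : ℕ} (f : Fin n → Fin r) (z : Fin r) :
    ∑ i, hardMatrix f i z = (cluster f z).card / n := by
  simp only [hardMatrix, cluster, eq_comm (a := z)]
  rw [← Finset.sum_filter, Finset.sum_const, nsmul_eq_mul, mul_one_div]

lemma IsHard.card_cluster {n r : ℕ} (hn : 0 < n) (hr : 0 < r) (hdvd : r ∣ n)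
    {f : Fin n → Fin r} (hf : IsHard (hardMatrix f)) (k : Fin r) :
    (cluster f k).card = n / r := by
  have hcol := hf.1.2.2 k
  have hn' : (n : ℝ) ≠ 0 := by positivity
  have hr' : (r : ℝ) ≠ 0 := by positivity
  rw [sum_hardMatrix_col, unif, div_eq_iff hn', one_div_mul_eq_div] at hcol
  have : ((cluster f k).card : ℝ) = ((n / r : ℕ) : ℝ) := by
    rw [hcol, Nat.cast_div hdvd hr']
  exact_mod_cast this

lemma isHard_hardMatrix {n r : ℕ} (hn : 0 < n) (hr : 0 < r) (hdvd : r ∣ n)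
    {f : Fin n → Fin r} (hf : ∀ k, (cluster f k).card = n / r) : IsHard (hardMatrix f) := by
  have hn' : (n : ℝ) ≠ 0 := by positivity
  have hr' : (r : ℝ) ≠ 0 := by positivity
  refine ⟨⟨fun i j => ?_, fun i => ?_, fun j => ?_⟩, fun i => ⟨f i, ?_, fun z hz => ?_⟩⟩
  · unfold hardMatrix
    split_ifs <;> positivity
  · simp [hardMatrix, unif]
  · rw [sum_hardMatrix_col, hf, unif, Nat.cast_div hdvd hr']
    field_simp
  · simpa [hardMatrix] using hn.ne'
  · by_contra h
    exact hz (by simp [hardMatrix, h])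

lemma frob_hardMatrix {n r : ℕ} (C : Matrix (Fin n) (Fin n) ℝ) (σ : Equiv.Perm (Fin n))
    (f g : Fin n → Fin r) :
    frob C (hardMatrix f * (hardMatrix g)ᵀ) =
      (1 / n * (1 / n)) * ∑ k, blockCost C σ (cluster f k) (cluster (g ∘ σ) k) := by
  have hblock : ∀ k, blockCost C σ (cluster f k) (cluster (g ∘ σ) k) =
      ∑ i, ∑ j, if k = f i then (if k = g j then C i j else 0) else 0 := fun k => by
    unfold blockCost cluster
    rw [Finset.sum_filter]
    refine Finset.sum_congr rfl fun i _ => ?_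
    rw [Finset.sum_filter, ← Equiv.sum_comp σ (fun j => if k = f i then _ else _)]
    simp only [Function.comp_apply, eq_comm (b := k)]
    split_ifs <;> simp
  simp_rw [hblock]
  rw [Finset.sum_comm, Finset.mul_sum]
  refine Finset.sum_congr rfl fun i _ => ?_
  rw [Finset.sum_comm, Finset.mul_sum]
  refine Finset.sum_congr rfl fun j _ => ?_
  rw [Matrix.mul_apply, Finset.mul_sum, Finset.mul_sum]
  refine Finset.sum_congr rfl fun k _ => ?_
  simp only [Matrix.transpose_apply, hardMatrix]
  split_ifs <;> ring

/-- Two clustering functions with the same cluster sizes differ by a permutation. -/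
lemma exists_perm_image_cluster_eq {n r : ℕ} {p f : Fin n → Fin r}
    (h : ∀ k, (cluster p k).card = (cluster f k).card) :
    ∃ π : Equiv.Perm (Fin n), ∀ k, (cluster p k).image π = cluster f k := by
  have e : ∀ k, Nonempty ({i // p i = k} ≃ {i // f i = k}) := fun k => by
    rw [← Fintype.card_eq, Fintype.card_subtype, Fintype.card_subtype]
    exact h k
  refine ⟨Equiv.ofFiberEquiv fun k => (e k).some, fun k => ?_⟩
  set π := Equiv.ofFiberEquiv fun k => (e k).some
  have hπ : ∀ i, f (π i) = p i := fun i => Equiv.ofFiberEquiv_map _ i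
  ext i
  rw [Finset.mem_image, mem_cluster]
  constructor
  · rintro ⟨j, hj, rfl⟩
    rw [hπ, mem_cluster.1 hj]
  · intro hi
    exact ⟨π.symm i, by rw [mem_cluster, ← hπ, π.apply_symm_apply, hi], π.apply_symm_apply i⟩

lemma IsBalancedPartition.exists_cluster_eq {n r : ℕ} {I : Fin r → Finset (Fin n)}
    (hI : IsBalancedPartition I) : ∃ p : Fin n → Fin r, ∀ k, cluster p k = I k := by
  obtain ⟨-, hdisj, hcov⟩ := hI
  choose p hp using hcov
  refine ⟨p, fun k => ?_⟩
  ext i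
  rw [mem_cluster]
  refine ⟨fun h => h ▸ hp i, fun hi => ?_⟩
  by_contra h
  exact Finset.disjoint_left.1 (hdisj _ _ h) (hp i) hi

lemma card_cluster_comp_perm {n r : ℕ} (f : Fin n → Fin r) (σ : Equiv.Perm (Fin n))
    (k : Fin r) : (cluster (f ∘ σ) k).card = (cluster f k).card :=
  Finset.card_bij (fun i _ => σ i) (fun i hi => by simpa [mem_cluster] using hi)
    (fun _ _ _ _ h => σ.injective h)
    (fun i hi => ⟨σ.symm i, by simpa [mem_cluster] using hi, σ.apply_symm_apply i⟩)

/-- Optimal hard low-rank factors co-cluster each index `i`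
with its image `σ†(i)` under the optimal assignment. -/
theorem optimal_hard_factors_cocluster_monge_pairs
    {n r : ℕ} (hn : 0 < n) (hr : 0 < r) (hdvd : r ∣ n)
    (C : Matrix (Fin n) (Fin n) ℝ) (σ : Equiv.Perm (Fin n))
    (hσ : ∀ τ : Equiv.Perm (Fin n), ∑ i, C i (σ i) ≤ ∑ i, C i (τ i))
    (I : Fin r → Finset (Fin n))
    (hsep : IsStrictlyMongeSeparableWith C σ I)
    (Qs Rs : Matrix (Fin n) (Fin r) ℝ)
    (hQs : IsHard Qs) (hRs : IsHard Rs)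
    (hmin : ∀ Q R : Matrix (Fin n) (Fin r) ℝ, IsHard Q → IsHard R →
      frob C (Qs * Rsᵀ) ≤ frob C (Q * Rᵀ))
    (q rc : Fin n → Fin r)
    (hq : ∀ i z, Qs i z ≠ 0 ↔ z = q i)
    (hrc : ∀ i z, Rs i z ≠ 0 ↔ z = rc i) :
    ∀ i, q i = rc (σ i) := by
  obtain ⟨hI, hmonge⟩ := hsep
  obtain ⟨p, hp⟩ := hI.exists_cluster_eq
  have hpcard : ∀ k, (cluster p k).card = n / r := fun k => by rw [hp, hI.1]
  obtain rfl := hQs.eq_hardMatrix hq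
  obtain rfl := hRs.eq_hardMatrix hrc
  obtain ⟨π₁, hπ₁⟩ := exists_perm_image_cluster_eq (p := p) (f := q) fun k => by
    rw [hpcard, hQs.card_cluster hn hr hdvd]
  obtain ⟨π₂, hπ₂⟩ := exists_perm_image_cluster_eq (p := p) (f := rc ∘ σ) fun k => by
    rw [hpcard, card_cluster_comp_perm, hRs.card_cluster hn hr hdvd]
  intro i
  by_contra hne
  have hlt := (hmonge π₁ π₂).2 ⟨q i, fun h => by
    rw [← hp, hπ₁, hπ₂] at h
    have hi : i ∈ cluster (rc ∘ σ) (q i) := h ▸ mem_cluster.2 rfl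
    exact hne (mem_cluster.1 hi).symm⟩
  simp_rw [← hp, hπ₁, hπ₂] at hlt
  have hle := hmin (hardMatrix p) (hardMatrix (p ∘ σ.symm))
    (isHard_hardMatrix hn hr hdvd hpcard)
    (isHard_hardMatrix hn hr hdvd fun k => by rw [card_cluster_comp_perm, hpcard])
  have hcomp : (p ∘ σ.symm) ∘ σ = p := by
    ext j
    simp
  rw [frob_hardMatrix C σ, frob_hardMatrix C σ, hcomp] at hle
  have hpos : (0 : ℝ) < 1 / n * (1 / n) := by positivity
  exact hlt.not_ge (le_of_mul_le_mul_left hle hpos)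
end
end

section
/- Let n be even and let C ∈ ℝ^{n×n}. The minimum of (Q,R) ↦ ⟨C, Q · diag(1/g) · Rᵀ⟩_F over Q, R ∈ Π(u_n, u_2), where g = (1/2, 1/2), is attained at a pair (Q*, R*) with Q*, R* ∈ Π_•(u_n, u_2); that is, each row of Q* and each row of R* has exactly one nonzero entry, equal to 1/n, and for each factor the supports of its two columns partition [n] into two sets of size n/2. -/
open Matrix Finset

noncomputable section

/-- `g = (1/2, 1/2)`. -/
def gvec : Fin 2 → ℝ := fun _ => 1 / 2

/-- The minimum of a linear functional over the hypersimplex `{x ∈ [0,1]^ι | ∑ x = k}` is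
attained at the indicator of a `k`-element set. -/
theorem exists_card_eq_sum_le_sum_mul {ι : Type*} [Fintype ι] {k : ℕ} (hk : 0 < k)
    (w x : ι → ℝ) (hx0 : ∀ i, 0 ≤ x i) (hx1 : ∀ i, x i ≤ 1) (hx : ∑ i, x i = k) :
    ∃ S : Finset ι, S.card = k ∧ ∑ i ∈ S, w i ≤ ∑ i, x i * w i := by
  classical
  have hkc : k ≤ (Finset.univ : Finset ι).card := by
    have h : ∑ i, x i ≤ ∑ _i : ι, (1 : ℝ) := Finset.sum_le_sum fun i _ => hx1 i
    rw [hx, Finset.sum_const, nsmul_eq_mul, mul_one] at h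
    exact_mod_cast h
  obtain ⟨S, hS, hmin⟩ := Finset.exists_min_image _ (fun S : Finset ι => ∑ i ∈ S, w i)
    (Finset.powersetCard_nonempty.2 hkc)
  have hcard : S.card = k := (Finset.mem_powersetCard.1 hS).2
  have hexch : ∀ i ∈ S, ∀ j ∉ S, w i ≤ w j := by
    intro i hi j hj
    have hj' : j ∉ S.erase i := fun h => hj (Finset.mem_of_mem_erase h)
    have h := hmin (insert j (S.erase i)) (Finset.mem_powersetCard.2 ⟨Finset.subset_univ _, by
      rw [Finset.card_insert_of_notMem hj', Finset.card_erase_add_one hi, hcard]⟩)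
    simp only [Finset.sum_insert hj', ← Finset.add_sum_erase S w hi] at h
    linarith
  obtain ⟨m, hm, hmax⟩ := Finset.exists_max_image S w (Finset.card_pos.1 (by omega))
  refine ⟨S, hcard, ?_⟩
  have hnonneg : 0 ≤ ∑ i, (x i - if i ∈ S then 1 else 0) * (w i - w m) := by
    refine Finset.sum_nonneg fun i _ => ?_
    split_ifs with hi
    · exact mul_nonneg_of_nonpos_of_nonpos (by linarith [hx1 i]) (by linarith [hmax i hi])
    · exact mul_nonneg (by linarith [hx0 i]) (by linarith [hexch m hm i hi])
  have hsum : ∑ i, (x i - if i ∈ S then 1 else 0) * (w i - w m) =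
      ∑ i, x i * w i - ∑ i ∈ S, w i - (∑ i, x i - S.card) * w m := by
    simp only [sub_mul, mul_sub, Finset.sum_sub_distrib, ite_mul, one_mul, zero_mul,
      Finset.sum_ite_mem, Finset.univ_inter, Finset.sum_mul, Finset.sum_const, nsmul_eq_mul]
  rw [hsum, hx, hcard] at hnonneg
  linarith

/-- The coupling sending the mass of `S` to the first column and the rest to the second. -/
def partitionCoupling {n : ℕ} (S : Finset (Fin n)) : Matrix (Fin n) (Fin 2) ℝ :=
  fun i z => if i ∈ S ↔ z = 0 then 1 / n else 0

theorem isHard_partitionCoupling {n k : ℕ} (hk : 0 < k) (hn : n = 2 * k) {S : Finset (Fin n)}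
    (hS : S.card = k) : IsHard (partitionCoupling S) := by
  have hkR : (k : ℝ) ≠ 0 := by positivity
  have hn' : (1 / n : ℝ) ≠ 0 := by
    rw [hn]; positivity
  have hrow : ∀ i, ∑ z, partitionCoupling S i z = 1 / n := by
    intro i
    by_cases hi : i ∈ S <;> simp [partitionCoupling, hi]
  have hcol : ∑ i, partitionCoupling S i 0 = 1 / 2 := by
    simp only [partitionCoupling, iff_true, Finset.sum_ite_mem, Finset.univ_inter,
      Finset.sum_const, nsmul_eq_mul, hS, hn]
    push_cast
    field_simp
  refine ⟨⟨fun i z => ?_, hrow, fun z => ?_⟩, fun i => ?_⟩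
  · unfold partitionCoupling
    split_ifs <;> positivity
  · have htot : ∑ i, partitionCoupling S i 0 + ∑ i, partitionCoupling S i 1 = 1 := by
      rw [← Finset.sum_add_distrib]
      simp only [← Fin.sum_univ_two, hrow]
      simp only [Finset.sum_const, Finset.card_univ, Fintype.card_fin, nsmul_eq_mul]
      exact mul_one_div_cancel (by simpa using hn')
    fin_cases z
    · simpa [unif] using hcol
    · simp only [unif, Fin.mk_one, Nat.cast_ofNat]
      linarith
  · by_cases hi : i ∈ S
    · refine ⟨0, by simpa [partitionCoupling, hi] using hn', fun z hz => ?_⟩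
      by_contra h
      simp [partitionCoupling, hi, h] at hz
    · refine ⟨1, by simpa [partitionCoupling, hi] using hn', fun z hz => ?_⟩
      by_contra h
      have h0 : z = 0 := by omega
      simp [partitionCoupling, hi, h0] at hz

theorem frob_transpose {n m : ℕ} (A B : Matrix (Fin n) (Fin m) ℝ) :
    frob Aᵀ Bᵀ = frob A B :=
  Finset.sum_comm

theorem frob_mul_diagonal_swap {n m r : ℕ} (C : Matrix (Fin n) (Fin m) ℝ) (d : Fin r → ℝ)
    (Q : Matrix (Fin n) (Fin r) ℝ) (R : Matrix (Fin m) (Fin r) ℝ) :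
    frob Cᵀ (R * Matrix.diagonal d * Qᵀ) = frob C (Q * Matrix.diagonal d * Rᵀ) := by
  rw [← frob_transpose C]
  simp [Matrix.transpose_mul, Matrix.mul_assoc]

/-- With constant row sums, the rank-two objective is affine in the first column of `Q`. -/
theorem frob_eq_sum_mul_add {n m : ℕ} (C : Matrix (Fin n) (Fin m) ℝ) (d : Fin 2 → ℝ)
    {Q : Matrix (Fin n) (Fin 2) ℝ} {c : ℝ} (hQ : ∀ i, ∑ z, Q i z = c)
    (R : Matrix (Fin m) (Fin 2) ℝ) :
    frob C (Q * Matrix.diagonal d * Rᵀ) =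
      ∑ i, Q i 0 * ∑ j, C i j * (d 0 * R j 0 - d 1 * R j 1) +
        c * ∑ i, ∑ j, C i j * (d 1 * R j 1) := by
  simp only [frob, Finset.mul_sum, ← Finset.sum_add_distrib]
  refine Finset.sum_congr rfl fun i _ => Finset.sum_congr rfl fun j _ => ?_
  have h1 : Q i 1 = c - Q i 0 := by
    rw [← hQ i, Fin.sum_univ_two]; ring
  rw [Matrix.mul_apply, Fin.sum_univ_two, Matrix.mul_diagonal, Matrix.mul_diagonal, h1]
  simp only [Matrix.transpose_apply]
  ring

theorem exists_partitionCoupling_frob_le {n m k : ℕ} (hk : 0 < k) (hn : n = 2 * k)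
    (C : Matrix (Fin n) (Fin m) ℝ) (d : Fin 2 → ℝ) {Q : Matrix (Fin n) (Fin 2) ℝ}
    (hQ : InPolytope (unif n) (unif 2) Q) (R : Matrix (Fin m) (Fin 2) ℝ) :
    ∃ S : Finset (Fin n), S.card = k ∧
      frob C (partitionCoupling S * Matrix.diagonal d * Rᵀ) ≤
        frob C (Q * Matrix.diagonal d * Rᵀ) := by
  obtain ⟨hpos, hrow, hcol⟩ := hQ
  have hnR : (0 : ℝ) < n := by
    rw [hn]; positivity
  set w : Fin n → ℝ := fun i => ∑ j, C i j * (d 0 * R j 0 - d 1 * R j 1) with hw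
  obtain ⟨S, hS, hle⟩ := exists_card_eq_sum_le_sum_mul hk w (fun i => n * Q i 0)
    (fun i => mul_nonneg hnR.le (hpos i 0))
    (fun i => by
      have h := hrow i
      rw [Fin.sum_univ_two, unif] at h
      have hle : Q i 0 ≤ 1 / n := by linarith [hpos i 1]
      rwa [le_div_iff₀ hnR, mul_comm] at hle)
    (by
      rw [← Finset.mul_sum, hcol, unif, hn]
      push_cast
      ring)
  refine ⟨S, hS, ?_⟩
  rw [frob_eq_sum_mul_add C d hrow,
    frob_eq_sum_mul_add C d (isHard_partitionCoupling hk hn hS).1.2.1]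
  refine add_le_add ?_ le_rfl
  have hsum : ∑ i, partitionCoupling S i 0 * w i = 1 / n * ∑ i ∈ S, w i := by
    simp [partitionCoupling, Finset.mul_sum]
  have hsum' : ∑ i, Q i 0 * w i = 1 / n * ∑ i, n * Q i 0 * w i := by
    rw [Finset.mul_sum]
    refine Finset.sum_congr rfl fun i _ => ?_
    field_simp
  change ∑ i, partitionCoupling S i 0 * w i ≤ ∑ i, Q i 0 * w i
  rw [hsum, hsum']
  exact mul_le_mul_of_nonneg_left hle (by positivity)

/-- For `n` even, the rank-2 problem
`min ⟨C, Q diag(1/g) Rᵀ⟩_F` over `Π(u_n,u_2)²` with `g = (1/2,1/2)` is attained at a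
pair of hard couplings, i.e. at `(Q*, R*) ∈ Π_•(u_n,u_2)²`. -/
theorem rank_two_minimizer_is_hard_partition
    {n : ℕ} (hn : 0 < n) (heven : 2 ∣ n)
    (C : Matrix (Fin n) (Fin n) ℝ) :
    ∃ Qs Rs : Matrix (Fin n) (Fin 2) ℝ, IsHard Qs ∧ IsHard Rs ∧
      ∀ Q R : Matrix (Fin n) (Fin 2) ℝ,
        InPolytope (unif n) (unif 2) Q → InPolytope (unif n) (unif 2) R →
          frob C (Qs * Matrix.diagonal (fun z => 1 / gvec z) * Rsᵀ) ≤
            frob C (Q * Matrix.diagonal (fun z => 1 / gvec z) * Rᵀ) := by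
  obtain ⟨k, hk⟩ := heven
  have hkpos : 0 < k := by omega
  set d : Fin 2 → ℝ := fun z => 1 / gvec z
  have hne : (Finset.powersetCard k (Finset.univ : Finset (Fin n))).Nonempty :=
    Finset.powersetCard_nonempty.2 (by rw [Finset.card_univ, Fintype.card_fin]; omega)
  obtain ⟨p, hp, hmin⟩ := Finset.exists_min_image _
    (fun p : Finset (Fin n) × Finset (Fin n) =>
      frob C (partitionCoupling p.1 * Matrix.diagonal d * (partitionCoupling p.2)ᵀ))
    (hne.product hne)
  obtain ⟨hp1, hp2⟩ := Finset.mem_product.1 hp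
  refine ⟨partitionCoupling p.1, partitionCoupling p.2,
    isHard_partitionCoupling hkpos hk (Finset.mem_powersetCard.1 hp1).2,
    isHard_partitionCoupling hkpos hk (Finset.mem_powersetCard.1 hp2).2, fun Q R hQ hR => ?_⟩
  obtain ⟨S, hS, hSle⟩ := exists_partitionCoupling_frob_le hkpos hk C d hQ R
  obtain ⟨T, hT, hTle⟩ :=
    exists_partitionCoupling_frob_le hkpos hk Cᵀ d hR (partitionCoupling S)
  rw [frob_mul_diagonal_swap, frob_mul_diagonal_swap] at hTle
  exact (hmin (S, T) (Finset.mem_product.2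
    ⟨Finset.mem_powersetCard.2 ⟨Finset.subset_univ _, hS⟩,
      Finset.mem_powersetCard.2 ⟨Finset.subset_univ _, hT⟩⟩)).trans (hTle.trans hSle)
end
end

section
/- In the refinement setup, assume additionally that c(x,y) = h(x − y) for a convex function h : ℝ^d → ℝ, that c is L-Lipschitz as a function on ℝ^d × ℝ^d (with the Euclidean norm on the product), and that the refinement improves each block: for each q ∈ [ρ], Σ_{z=1}^r Σ_{i∈B_{q,z}} Σ_{j∈B_{q,z}} c(x_i, y_{τ(j)}) ≤ (1/r) · Σ_{i∈B_q} Σ_{j∈B_q} c(x_i, y_{τ(j)}). Then 0 ≤ ⟨C, P^coarse⟩_F − ⟨C, P^fine⟩_F ≤ (L/ρ) · Σ_{q=1}^ρ diam(Γ_q), where diam(Γ_q) := max over i, j, k, l ∈ B_q of ‖(x_i, y_{τ(j)}) − (x_k, y_{τ(l)})‖₂ (the Euclidean norm in ℝ^{2d}). -/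
open Matrix Finset

noncomputable section

/-- `ℝ^d × ℝ^d` equipped with the Euclidean (ℓ²) norm, i.e. `ℝ^{2d}`. -/
abbrev ProdL2 (d : ℕ) :=
  WithLp 2 (EuclideanSpace ℝ (Fin d) × EuclideanSpace ℝ (Fin d))

/-- The Frobenius product with a matrix equal to `a` on the blocks `A k × τ (A k)` and zero
elsewhere is `a` times the sum of the entries over these blocks. -/
lemma frob_blocks {n : ℕ} {κ : Type*} [Fintype κ] (C P : Matrix (Fin n) (Fin n) ℝ)
    (τ : Equiv.Perm (Fin n)) (A : κ → Finset (Fin n)) (a : ℝ)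
    (hdisj : ∀ k k', k ≠ k' → Disjoint (A k) (A k'))
    (hP : ∀ i j, (∃ k, i ∈ A k ∧ j ∈ A k) → P i (τ j) = a)
    (hP0 : ∀ i j, (¬ ∃ k, i ∈ A k ∧ j ∈ A k) → P i (τ j) = 0) :
    frob C P = a * ∑ k, ∑ i ∈ A k, ∑ j ∈ A k, C i (τ j) := by
  classical
  have hentry : ∀ i j, C i (τ j) * P i (τ j) =
      ∑ k, if i ∈ A k then (if j ∈ A k then a * C i (τ j) else 0) else 0 := by
    intro i j
    by_cases hk : ∃ k, i ∈ A k ∧ j ∈ A k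
    · rw [hP i j hk]
      obtain ⟨k, hi, hj⟩ := hk
      rw [Finset.sum_eq_single k, if_pos hi, if_pos hj, mul_comm]
      · intro k' _ hne
        rw [if_neg]
        exact fun hi' => Finset.disjoint_left.mp (hdisj k' k hne) hi' hi
      · simp
    · rw [hP0 i j hk, mul_zero, Finset.sum_eq_zero]
      intro k _
      split_ifs with hi hj
      · exact (hk ⟨k, hi, hj⟩).elim
      · rfl
      · rfl
  calc frob C P = ∑ i, ∑ j, C i (τ j) * P i (τ j) :=
        Finset.sum_congr rfl fun i _ => (Equiv.sum_comp τ fun j => C i j * P i j).symm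
    _ = ∑ i, ∑ k, ∑ j, if i ∈ A k then (if j ∈ A k then a * C i (τ j) else 0) else 0 := by
        refine Finset.sum_congr rfl fun i _ => ?_
        rw [Finset.sum_comm]
        exact Finset.sum_congr rfl fun j _ => hentry i j
    _ = ∑ k, ∑ i ∈ A k, ∑ j ∈ A k, a * C i (τ j) := by
        rw [Finset.sum_comm]
        refine Finset.sum_congr rfl fun k _ => ?_
        simp [Finset.sum_ite_irrel]
    _ = _ := by simp only [Finset.mul_sum]

/-- If the values of `f` on `S × S` differ by at most `D`, then the sum of `f` over `S × S` exceeds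
`r` times its sum over the diagonal blocks of `r` subsets of size `t`, with `#S = r * t`, by at
most `#S ^ 2 * D`. -/
lemma sum_sub_mul_sum_blocks_le {α : Type*} {r t : ℕ} (f : α → α → ℝ) (S : Finset α)
    (T : Fin r → Finset α) (D : ℝ) (hS : S.card = r * t) (hT : ∀ z, (T z).card = t)
    (hsub : ∀ z, T z ⊆ S)
    (hD : ∀ i ∈ S, ∀ j ∈ S, ∀ k ∈ S, ∀ l ∈ S, f i j - f k l ≤ D) :
    ∑ i ∈ S, ∑ j ∈ S, f i j - r * ∑ z, ∑ i ∈ T z, ∑ j ∈ T z, f i j ≤ ((r * t : ℕ) : ℝ) ^ 2 * D := by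
  rcases S.eq_empty_or_nonempty with rfl | hne
  · have hT' : ∀ z, T z = ∅ := fun z => Finset.subset_empty.mp (hsub z)
    rw [← hS]
    simp [hT']
  obtain ⟨p, hp, hmin⟩ := (S ×ˢ S).exists_min_image (fun p => f p.1 p.2) (hne.product hne)
  obtain ⟨hp1, hp2⟩ := Finset.mem_product.mp hp
  set v := f p.1 p.2
  have hupper : ∑ i ∈ S, ∑ j ∈ S, f i j ≤ ∑ i ∈ S, ∑ j ∈ S, (v + D) :=
    Finset.sum_le_sum fun i hi => Finset.sum_le_sum fun j hj => by
      linarith [hD i hi j hj _ hp1 _ hp2]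
  have hlower : ∑ z, ∑ i ∈ T z, ∑ j ∈ T z, v ≤ ∑ z, ∑ i ∈ T z, ∑ j ∈ T z, f i j :=
    Finset.sum_le_sum fun z _ => Finset.sum_le_sum fun i hi => Finset.sum_le_sum fun j hj =>
      hmin (i, j) (Finset.mem_product.mpr ⟨hsub z hi, hsub z hj⟩)
  simp only [Finset.sum_const, hS, hT, nsmul_eq_mul, Finset.card_univ, Fintype.card_fin] at *
  have := mul_le_mul_of_nonneg_left hlower (Nat.cast_nonneg (α := ℝ) r)
  push_cast at *
  linarith

/-- An iterated supremum over a finite type dominates each value. -/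
lemma le_iSup_four {ι : Type*} [Finite ι] (g : ι → ι → ι → ι → ℝ) (i j k l : ι) :
    g i j k l ≤ ⨆ i, ⨆ j, ⨆ k, ⨆ l, g i j k l :=
  calc g i j k l ≤ ⨆ l, g i j k l := le_ciSup (Set.finite_range _).bddAbove l
    _ ≤ ⨆ k, ⨆ l, g i j k l :=
      le_ciSup (f := fun k => ⨆ l, g i j k l) (Set.finite_range _).bddAbove k
    _ ≤ ⨆ j, ⨆ k, ⨆ l, g i j k l :=
      le_ciSup (f := fun j => ⨆ k, ⨆ l, g i j k l) (Set.finite_range _).bddAbove j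
    _ ≤ _ := le_ciSup (f := fun i => ⨆ j, ⨆ k, ⨆ l, g i j k l) (Set.finite_range _).bddAbove i

/-- Under convexity and Lipschitzness of the cost, the one-step
refinement cost difference is nonnegative and bounded above by the average
diameter of the coarse co-clusters. -/
theorem refinement_one_step_bound
    {d n ρ r : ℕ} (hρ : 0 < ρ) (hr : 0 < r) (hdvd : ρ * r ∣ n)
    (x y : Fin n → EuclideanSpace ℝ (Fin d))
    (τ : Equiv.Perm (Fin n))
    (c : EuclideanSpace ℝ (Fin d) → EuclideanSpace ℝ (Fin d) → ℝ)
    (C : Matrix (Fin n) (Fin n) ℝ) (hC : ∀ i j, C i j = c (x i) (y j))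
    -- cost of the form c(x,y) = h(x - y) with h convex
    (h : EuclideanSpace ℝ (Fin d) → ℝ)
    (hconv : ConvexOn ℝ Set.univ h)
    (hch : ∀ a b : EuclideanSpace ℝ (Fin d), c a b = h (a - b))
    -- c is L-Lipschitz on the product with the Euclidean norm on ℝ^{2d}
    (L : NNReal)
    (hlip : LipschitzWith L (fun p : ProdL2 d =>
      c (WithLp.equiv 2 _ p).1 (WithLp.equiv 2 _ p).2))
    -- the balanced coarse partition {B_q}
    (B : Fin ρ → Finset (Fin n))
    (hBcard : ∀ q, (B q).card = n / ρ)
    (hBdisj : ∀ q q', q ≠ q' → Disjoint (B q) (B q'))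
    (hBcover : ∀ i, ∃ q, i ∈ B q)
    -- the balanced refinement {B_{q,z}}
    (B2 : Fin ρ → Fin r → Finset (Fin n))
    (hB2card : ∀ q z, (B2 q z).card = n / (ρ * r))
    (hB2disj : ∀ q z z', z ≠ z' → Disjoint (B2 q z) (B2 q z'))
    (hB2sub : ∀ q z, B2 q z ⊆ B q)
    (hB2cover : ∀ q, ∀ i ∈ B q, ∃ z, i ∈ B2 q z)
    -- the refinement improves each block
    (himp : ∀ q, ∑ z, ∑ i ∈ B2 q z, ∑ j ∈ B2 q z, c (x i) (y (τ j)) ≤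
      (1 / (r : ℝ)) * ∑ i ∈ B q, ∑ j ∈ B q, c (x i) (y (τ j)))
    -- the coarse and fine hierarchical block couplings
    (Pc Pf : Matrix (Fin n) (Fin n) ℝ)
    (hPc : ∀ i j, Pc i j =
      if ∃ q, i ∈ B q ∧ j ∈ (B q).image τ then (ρ : ℝ) / (n ^ 2) else 0)
    (hPf : ∀ i j, Pf i j =
      if ∃ q z, i ∈ B2 q z ∧ j ∈ (B2 q z).image τ then ((ρ * r : ℕ) : ℝ) / (n ^ 2) else 0) :
    0 ≤ frob C Pc - frob C Pf ∧
      frob C Pc - frob C Pf ≤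
        (L : ℝ) / ρ *
          ∑ q, ⨆ i : B q, ⨆ j : B q, ⨆ k : B q, ⨆ l : B q,
            ‖(WithLp.equiv 2 _).symm ((x i, y (τ j)) :
                EuclideanSpace ℝ (Fin d) × EuclideanSpace ℝ (Fin d)) -
              (WithLp.equiv 2 _).symm ((x k, y (τ l)) :
                EuclideanSpace ℝ (Fin d) × EuclideanSpace ℝ (Fin d))‖ := by
  obtain ⟨t, ht⟩ := hdvd
  have hρr : 0 < ρ * r := Nat.mul_pos hρ hr
  have hcoarse : frob C Pc =
      (ρ : ℝ) / n ^ 2 * ∑ q, ∑ i ∈ B q, ∑ j ∈ B q, c (x i) (y (τ j)) := by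
    rw [frob_blocks C Pc τ B ((ρ : ℝ) / n ^ 2) hBdisj]
    · simp only [hC]
    · intro i j hq
      rw [hPc, if_pos]
      simpa using hq
    · intro i j hq
      rw [hPc, if_neg]
      simpa using hq
  have hfine : frob C Pf = ((ρ * r : ℕ) : ℝ) / n ^ 2 *
      ∑ q, ∑ z, ∑ i ∈ B2 q z, ∑ j ∈ B2 q z, c (x i) (y (τ j)) := by
    rw [frob_blocks C Pf τ (fun p : Fin ρ × Fin r => B2 p.1 p.2) (((ρ * r : ℕ) : ℝ) / n ^ 2)]
    · simp only [hC, Fintype.sum_prod_type]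
    · rintro ⟨q, z⟩ ⟨q', z'⟩ hne
      by_cases hq : q = q'
      · subst hq
        exact hB2disj q z z' fun hz => hne (by rw [hz])
      · exact (hBdisj q q' hq).mono (hB2sub q z) (hB2sub q' z')
    · intro i j hq
      rw [hPf, if_pos]
      simpa using hq
    · intro i j hq
      rw [hPf, if_neg]
      simpa using hq
  have hdiff : frob C Pc - frob C Pf = (ρ : ℝ) / n ^ 2 *
      ∑ q, (∑ i ∈ B q, ∑ j ∈ B q, c (x i) (y (τ j)) -
        r * ∑ z, ∑ i ∈ B2 q z, ∑ j ∈ B2 q z, c (x i) (y (τ j))) := by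
    rw [hcoarse, hfine, Finset.sum_sub_distrib, ← Finset.mul_sum]
    push_cast
    ring
  rw [hdiff]
  constructor
  · refine mul_nonneg (by positivity) (Finset.sum_nonneg fun q _ => sub_nonneg.mpr ?_)
    have hr' : (0 : ℝ) < r := Nat.cast_pos.mpr hr
    have himp' := himp q
    rwa [one_div_mul_eq_div, le_div_iff₀ hr', mul_comm] at himp'
  · have hSn : n / ρ = r * t := by
      rw [ht, mul_assoc, Nat.mul_div_cancel_left _ hρ]
    have hTn : n / (ρ * r) = t := by
      rw [ht, Nat.mul_div_cancel_left _ hρr]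
    have hblock := fun q => sum_sub_mul_sum_blocks_le (fun i j => c (x i) (y (τ j))) (B q) (B2 q)
      (L * ⨆ i : B q, ⨆ j : B q, ⨆ k : B q, ⨆ l : B q,
            ‖(WithLp.equiv 2 _).symm ((x i, y (τ j)) :
                EuclideanSpace ℝ (Fin d) × EuclideanSpace ℝ (Fin d)) -
              (WithLp.equiv 2 _).symm ((x k, y (τ l)) :
                EuclideanSpace ℝ (Fin d) × EuclideanSpace ℝ (Fin d))‖)
      ((hBcard q).trans hSn) (fun z => (hB2card q z).trans hTn) (hB2sub q) (by
        intro i hi j hj k hk l hl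
        have hdist := hlip.dist_le_mul
          ((WithLp.equiv 2 _).symm (x i, y (τ j))) ((WithLp.equiv 2 _).symm (x k, y (τ l)))
        rw [Real.dist_eq, dist_eq_norm] at hdist
        refine (le_abs_self _).trans (hdist.trans (mul_le_mul_of_nonneg_left ?_ L.coe_nonneg))
        exact le_iSup_four (fun i j k l : B q => ‖(WithLp.equiv 2 _).symm ((x i, y (τ j)) :
                EuclideanSpace ℝ (Fin d) × EuclideanSpace ℝ (Fin d)) -
              (WithLp.equiv 2 _).symm ((x k, y (τ l)) :
                EuclideanSpace ℝ (Fin d) × EuclideanSpace ℝ (Fin d))‖)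
          ⟨i, hi⟩ ⟨j, hj⟩ ⟨k, hk⟩ ⟨l, hl⟩)
    refine (mul_le_mul_of_nonneg_left (Finset.sum_le_sum fun q _ => hblock q)
      (by positivity)).trans ?_
    rw [← Finset.mul_sum, ← Finset.mul_sum, ← mul_assoc, ← mul_assoc]
    refine mul_le_mul_of_nonneg_right ?_ (Finset.sum_nonneg fun q _ =>
      Real.iSup_nonneg fun i => Real.iSup_nonneg fun j => Real.iSup_nonneg fun k =>
        Real.iSup_nonneg fun l => norm_nonneg _)
    have hρ' : (0 : ℝ) < ρ := Nat.cast_pos.mpr hρ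
    rcases Nat.eq_zero_or_pos n with rfl | hn
    · simp only [Nat.cast_zero, ne_eq, OfNat.ofNat_ne_zero, not_false_eq_true, zero_pow, div_zero,
        zero_mul]
      positivity
    · have hn' : (n : ℝ) = ρ * (r * t : ℕ) := by
        rw [ht]
        push_cast
        ring
      have hrt : ((r * t : ℕ) : ℝ) ≠ 0 := by
        intro h0
        rw [h0, mul_zero, Nat.cast_eq_zero] at hn'
        omega
      rw [hn']
      apply le_of_eq
      field_simp
end
end
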